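/- Fix an integer d ≥ 1 and non-negative integers (g_k)_{k≥1} with g_k = 0 unless d | k, such that g(z) = Σ_{k≥1} g_k z^k belongs to the class S_d with radius of convergence ρ ∈ (0,1). For n divisible by d admitting at least one multiset of total size n, let S_n be a uniformly random multiset of total size n, and let c(S_n) = Σ_{t∈T} S_n(t) denote its number of elements (components). Then c(S_n) converges in total variation, as n → ∞ along multiples of d, to 1 + Σ_{t∈T} R(t), where R is the Boltzmann random multiset with independent geometric coordinates. -/

import Mathlib

/-- A power series with coefficient sequence `g`, non-negative coefficients and radius of
convergence `ρ ∈ (0,∞)`, belongs to the class `𝒮_d`. -/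
def SubexpClass (d : ℕ) (g : ℕ → ℝ) (ρ : ℝ) : Prop :=
  1 ≤ d ∧ 0 < ρ ∧ (∀ n, 0 ≤ g n) ∧
  (∀ n, ¬ d ∣ n → g n = 0) ∧
  (∃ N, ∀ n, N ≤ n → d ∣ n → 0 < g n) ∧
  Summable (fun n => g n * ρ ^ n) ∧
  (∀ r : ℝ, ρ < r → ¬ Summable (fun n => g n * r ^ n)) ∧
  Filter.Tendsto (fun m => g (d * m) / g (d * m + d)) Filter.atTop (nhds (ρ ^ d)) ∧
  Filter.Tendsto
    (fun m => (∑ i ∈ Finset.range (d * m + 1), g i * g (d * m - i)) / g (d * m))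
    Filter.atTop (nhds (2 * ∑' n, g n * ρ ^ n))


/-- The type of objects ("types"): `g k` distinct objects of each size `k`. -/
abbrev MTy (g : ℕ → ℕ) : Type := Σ k : ℕ, Fin (g k)

/-- The total size of a multiset `m : MTy g →₀ ℕ`: `∑_t m(t) · s(t)`, where the size of the
object `t = ⟨k, i⟩` is `s(t) = k`. -/
def msize (g : ℕ → ℕ) (m : MTy g →₀ ℕ) : ℕ := m.sum fun t c => c * t.1

/-- The point mass at `m` of the uniform distribution on multisets of total size `n`. -/
noncomputable def pUnif (g : ℕ → ℕ) (n : ℕ) (m : MTy g →₀ ℕ) : ℝ :=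
  if msize g m = n then ((Nat.card {m' : MTy g →₀ ℕ // msize g m' = n} : ℝ))⁻¹ else 0

/-- The point mass at `m` of the Boltzmann random multiset `R` with independent geometric
coordinates `ℙ(R(t) = j) = (1 - ρ^{s(t)}) ρ^{j s(t)}`: it equals
`(∏_t (1 - ρ^{s(t)})) · ρ^{|m|}`. -/
noncomputable def pBoltz (g : ℕ → ℕ) (ρ : ℝ) (m : MTy g →₀ ℕ) : ℝ :=
  (∏' t : MTy g, (1 - ρ ^ t.1)) * ρ ^ (msize g m)

/-- The total variation distance between two probability mass functions on a countable
state space: `sup_E |ℙ(X ∈ E) - ℙ(Y ∈ E)|`. -/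
noncomputable def dTV {S : Type*} (p q : S → ℝ) : ℝ :=
  ⨆ E : Set S, |(∑' x : E, p x) - ∑' x : E, q x|

/-- The number of elements (components) of a multiset. -/
def ccount (g : ℕ → ℕ) (m : MTy g →₀ ℕ) : ℕ := m.sum fun _ c => c

open Filter Topology

lemma aux_shift (f : ℕ → ℝ) (hpos : ∃ N, ∀ n, N ≤ n → 0 < f n)
    (hr : Tendsto (fun m => f m / f (m + 1)) atTop (𝓝 1)) (j : ℕ) :
    Tendsto (fun m => f (m - j) / f m) atTop (𝓝 1) := by
  rw [← tendsto_add_atTop_iff_nat j]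
  simp only [Nat.add_sub_cancel]
  induction j with
  | zero =>
    obtain ⟨N, hN⟩ := hpos
    refine tendsto_const_nhds.congr' ?_
    filter_upwards [eventually_ge_atTop N] with m hm
    simp [div_self (hN m hm).ne']
  | succ j ih =>
    have h2 := (tendsto_add_atTop_iff_nat j).2 hr
    have h3 := ih.mul h2
    rw [one_mul] at h3
    refine h3.congr' ?_
    obtain ⟨N, hN⟩ := hpos
    filter_upwards [eventually_ge_atTop N] with m hm
    have := (hN (m+j) (by omega)).ne'
    have := (hN (m+j+1) (by omega)).ne'
    rw [← add_assoc]
    field_simp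

lemma aux_geom (f : ℕ → ℝ) (hpos : ∃ N, ∀ n, N ≤ n → 0 < f n)
    (hr : Tendsto (fun m => f m / f (m + 1)) atTop (𝓝 1)) (q : ℝ) (hq0 : 0 < q) (hq : q < 1) :
    Tendsto (fun m => q ^ m / f m) atTop (𝓝 0) := by
  have hs : Summable (fun m => q ^ m / f m) := by
    obtain ⟨N, hN⟩ := hpos
    refine summable_of_ratio_test_tendsto_lt_one hq ?_ ?_
    · filter_upwards [eventually_ge_atTop N] with m hm
      have := hN m hm
      positivity
    · have h1 := hr.const_mul q
      rw [mul_one] at h1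
      refine h1.congr' ?_
      filter_upwards [eventually_ge_atTop N] with m hm
      have h0 := hN m hm
      have h1 := hN (m+1) (by omega)
      rw [Real.norm_of_nonneg (by positivity), Real.norm_of_nonneg (by positivity)]
      field_simp
      ring
  exact hs.tendsto_atTop_zero

lemma aux_mid (f : ℕ → ℝ) (hpos : ∃ N, ∀ n, N ≤ n → 0 < f n)
    (hr : Tendsto (fun m => f m / f (m + 1)) atTop (𝓝 1)) (F : ℝ)
    (hc : Tendsto (fun m => (∑ i ∈ Finset.range (m + 1), f i * f (m - i)) / f m) atTop
      (𝓝 (2 * F))) (K : ℕ) :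
    Tendsto (fun m => (∑ i ∈ Finset.Ioo K (m - K), f i * f (m - i)) / f m) atTop
      (𝓝 (2 * F - 2 * ∑ i ∈ Finset.range (K + 1), f i)) := by
  have h1 : Tendsto (fun m => ∑ i ∈ Finset.range (K + 1), f i * (f (m - i) / f m)) atTop
      (𝓝 (∑ i ∈ Finset.range (K + 1), f i)) := by
    have := tendsto_finsetSum (Finset.range (K+1))
      (fun i _ => (aux_shift f hpos hr i).const_mul (f i))
    simpa using this
  have h2 := hc.sub (h1.const_mul 2)
  refine h2.congr' ?_
  filter_upwards [eventually_ge_atTop (2 * K + 2)] with m hm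
  have e1 : ∑ i ∈ Finset.range (m + 1), f i * f (m - i) =
      ∑ i ∈ Finset.range (K + 1), f i * f (m - i) +
      ∑ i ∈ Finset.Ioo K (m - K), f i * f (m - i) +
      ∑ i ∈ Finset.Ico (m - K) (m + 1), f i * f (m - i) := by
    have : Finset.Ioo K (m - K) = Finset.Ico (K+1) (m-K) := by
      ext; simp only [Finset.mem_Ioo, Finset.mem_Ico]; omega
    rw [this, Finset.range_eq_Ico, Finset.range_eq_Ico, Finset.sum_Ico_consecutive _ (by omega) (by omega),
      Finset.sum_Ico_consecutive _ (by omega) (by omega)]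
  have e2 : ∑ i ∈ Finset.Ico (m - K) (m + 1), f i * f (m - i) =
      ∑ i ∈ Finset.range (K + 1), f i * f (m - i) := by
    refine Finset.sum_bij' (fun i _ => m - i) (fun i _ => m - i) ?_ ?_ ?_ ?_ ?_
    · intro i hi; simp at hi ⊢; omega
    · intro i hi; simp at hi ⊢; omega
    · intro i hi; simp at hi ⊢; omega
    · intro i hi; simp at hi ⊢; omega
    · intro i hi; simp at hi
      rw [show m - (m - i) = i by omega, mul_comm]
  rw [e1, e2]
  simp only [← mul_div_assoc]
  rw [← Finset.sum_div]
  ring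

lemma aux_main (f u : ℕ → ℝ) (hf : ∀ n, 0 ≤ f n) (hu : ∀ n, 0 ≤ u n)
    (hpos : ∃ N, ∀ n, N ≤ n → 0 < f n)
    (hr : Tendsto (fun m => f m / f (m + 1)) atTop (𝓝 1)) (F G : ℝ) (hF : HasSum f F)
    (hG : HasSum u G)
    (hc : Tendsto (fun m => (∑ i ∈ Finset.range (m + 1), f i * f (m - i)) / f m) atTop
      (𝓝 (2 * F)))
    (e : ℕ → ℕ → ℝ) (he : ∀ K, Tendsto (fun m => e K m / f m) atTop (𝓝 0))
    (hrec : ∀ K m, u m ≤ e K m + ∑ j ∈ Finset.range (K + 1), u j * f (m - j) +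
      ∑ i ∈ Finset.Ioo K (m - K), f i * u (m - i)) (C : ℝ) (hC : G < C) :
    ∀ᶠ m in atTop, u m ≤ C * f m := by
  have hG0 : 0 ≤ G := hG.nonneg hu
  obtain ⟨N0, hN0⟩ := hpos
  have key : ∀ ε > 0, ∀ K0, ∃ K, K0 ≤ K ∧ ∃ N, ∀ m, N ≤ m →
      (∑ i ∈ Finset.Ioo K (m - K), f i * f (m - i) ≤ ε * f m) ∧
      u m ≤ (G + 2 * ε) * f m + ∑ i ∈ Finset.Ioo K (m - K), f i * u (m - i) := by
    intro ε hε K0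
    have hK1 : ∀ᶠ K in atTop, F - ε / 2 < ∑ i ∈ Finset.range (K + 1), f i :=
      ((tendsto_add_atTop_iff_nat 1).2 hF.tendsto_sum_nat).eventually
        (lt_mem_nhds (by linarith))
    obtain ⟨K, hK1, hK0⟩ := (hK1.and (eventually_ge_atTop K0)).exists
    refine ⟨K, hK0, ?_⟩
    have a1 := (aux_mid f ⟨N0, hN0⟩ hr F hc K).eventually_lt_const
      (u := ε) (by linarith)
    have a2 := (he K).eventually_lt_const (u := ε) hε
    have a3 : Tendsto (fun m => ∑ j ∈ Finset.range (K + 1), u j * (f (m - j) / f m)) atTop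
        (𝓝 (∑ j ∈ Finset.range (K + 1), u j)) := by
      have := tendsto_finsetSum (Finset.range (K+1))
        (fun i _ => (aux_shift f ⟨N0, hN0⟩ hr i).const_mul (u i))
      simpa using this
    have hle : ∑ j ∈ Finset.range (K + 1), u j ≤ G := sum_le_hasSum _ (fun i _ => hu i) hG
    have a3 := a3.eventually_lt_const (u := G + ε) (by linarith)
    obtain ⟨N, hN⟩ := eventually_atTop.1 (((a1.and a2).and a3).and (eventually_ge_atTop N0))
    refine ⟨N, fun m hm => ?_⟩
    obtain ⟨⟨⟨b1, b2⟩, b3⟩, b4⟩ := hN m hm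
    have fp := hN0 m b4
    rw [div_lt_iff₀ fp] at b1 b2
    simp only [← mul_div_assoc] at b3
    rw [← Finset.sum_div, div_lt_iff₀ fp] at b3
    refine ⟨b1.le, ?_⟩
    have := hrec K m
    linarith
  obtain ⟨K, hKN, N, hN⟩ := key (1/2) (by norm_num) N0
  have hB : ∃ B, ∀ m, K < m → u m ≤ B * f m := by
    let B := 2 * (G + 1) + ∑ m ∈ Finset.range N, u m / f m
    have hS : ∀ m, 0 ≤ u m / f m := fun m => div_nonneg (hu m) (hf m)
    have hS0 : 0 ≤ ∑ m ∈ Finset.range N, u m / f m := Finset.sum_nonneg (fun m _ => hS m)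
    refine ⟨B, fun m => ?_⟩
    induction m using Nat.strong_induction_on with
    | _ m ih =>
    intro hm
    have fp := hN0 m (by omega)
    by_cases hmN : N ≤ m
    · obtain ⟨h1, h2⟩ := hN m hmN
      have h3 : ∑ i ∈ Finset.Ioo K (m - K), f i * u (m - i) ≤
          B * ∑ i ∈ Finset.Ioo K (m - K), f i * f (m - i) := by
        rw [Finset.mul_sum]
        refine Finset.sum_le_sum fun i hi => ?_
        simp at hi
        have := mul_le_mul_of_nonneg_left (ih (m - i) (by omega) (by omega)) (hf i)
        linarith
      have hB0 : 0 ≤ B := by positivity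
      have h4 := mul_le_mul_of_nonneg_left h1 hB0
      have h5 : (2 * (G + 1)) * f m ≤ B * f m := by
        apply mul_le_mul_of_nonneg_right _ fp.le
        simp only [B]; linarith
      nlinarith
    · rw [← div_le_iff₀ fp]
      have := Finset.single_le_sum (f := fun m => u m / f m) (fun m _ => hS m)
        (Finset.mem_range.2 (not_le.1 hmN))
      simp only [B]; linarith
  obtain ⟨B0, hB0⟩ := hB
  obtain ⟨B, hBp, hB⟩ : ∃ B, 0 ≤ B ∧ ∀ m, K < m → u m ≤ B * f m :=
    ⟨max B0 0, le_max_right _ _, fun m hm => (hB0 m hm).trans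
      (mul_le_mul_of_nonneg_right (le_max_left _ _) (hf m))⟩
  obtain ⟨K', hK', N', hN'⟩ := key ((C - G) / (2 + B)) (by apply div_pos <;> linarith) K
  filter_upwards [eventually_ge_atTop N'] with m hm
  obtain ⟨h1, h2⟩ := hN' m hm
  have h3 : ∑ i ∈ Finset.Ioo K' (m - K'), f i * u (m - i) ≤
      B * ∑ i ∈ Finset.Ioo K' (m - K'), f i * f (m - i) := by
    rw [Finset.mul_sum]
    refine Finset.sum_le_sum fun i hi => ?_
    simp at hi
    have := mul_le_mul_of_nonneg_left (hB (m - i) (by omega)) (hf i)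
    linarith
  have h4 := mul_le_mul_of_nonneg_left h1 hBp
  have h5 : (G + 2 * ((C - G) / (2 + B))) * f m + B * ((C - G) / (2 + B) * f m) = C * f m := by
    field_simp
    ring
  linarith
lemma msize_add (g : ℕ → ℕ) (x y : MTy g →₀ ℕ) : msize g (x + y) = msize g x + msize g y := by
  unfold msize
  exact Finsupp.sum_add_index' (by simp) (by intros; ring)

lemma msize_single (g : ℕ → ℕ) (t : MTy g) (j : ℕ) : msize g (Finsupp.single t j) = j * t.1 := by
  unfold msize
  exact Finsupp.sum_single_index (by simp)

lemma ccount_add (g : ℕ → ℕ) (x y : MTy g →₀ ℕ) :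
    ccount g (x + y) = ccount g x + ccount g y := by
  unfold ccount
  exact Finsupp.sum_add_index' (by simp) (by intros; ring)

lemma ccount_single (g : ℕ → ℕ) (t : MTy g) (j : ℕ) : ccount g (Finsupp.single t j) = j := by
  unfold ccount
  exact Finsupp.sum_single_index (by simp)

lemma ty_pos (g : ℕ → ℕ) (hg0 : g 0 = 0) (t : MTy g) : 0 < t.1 := by
  rcases t with ⟨k, i⟩
  rcases Nat.eq_zero_or_pos k with h | h
  · subst h; rw [hg0] at i; exact i.elim0
  · exact h

lemma le_msize (g : ℕ → ℕ) (x : MTy g →₀ ℕ) (t : MTy g) : x t * t.1 ≤ msize g x := by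
  by_cases h : t ∈ x.support
  · exact Finset.single_le_sum (f := fun t => x t * t.1) (fun _ _ => Nat.zero_le _) h
  · simp at h; simp [h]

lemma fin_msize (g : ℕ → ℕ) (hg0 : g 0 = 0) (n : ℕ) : {x : MTy g →₀ ℕ | msize g x = n}.Finite := by
  classical
  let s : Finset (MTy g) := (Finset.range (n + 1)).sigma (fun k => Finset.univ)
  let b : MTy g →₀ ℕ := Finsupp.indicator s (fun _ _ => n)
  refine (Set.finite_Iic b).subset ?_
  intro x hx
  simp only [Set.mem_ofPred_eq] at hx
  rw [Set.mem_Iic]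
  intro t
  have h1 := le_msize g x t
  have h2 := ty_pos g hg0 t
  rw [hx] at h1
  by_cases hx0 : x t = 0
  · rw [hx0]; exact Nat.zero_le _
  have hts : t ∈ s := by
    simp only [s, Finset.mem_sigma, Finset.mem_range, Finset.mem_univ, and_true]
    nlinarith [Nat.pos_of_ne_zero hx0]
  have : b t = n := Finsupp.indicator_of_mem hts _
  rw [this]
  nlinarith

/-- finset of multisets of size n -/
noncomputable def SS (g : ℕ → ℕ) (hg0 : g 0 = 0) (n : ℕ) : Finset (MTy g →₀ ℕ) :=
  (fin_msize g hg0 n).toFinset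

lemma mem_SS (g : ℕ → ℕ) (hg0 : g 0 = 0) (n : ℕ) (x) : x ∈ SS g hg0 n ↔ msize g x = n := by
  simp [SS]

lemma card_SS (g : ℕ → ℕ) (hg0 : g 0 = 0) (n : ℕ) :
    Nat.card {x : MTy g →₀ ℕ // msize g x = n} = (SS g hg0 n).card := by
  exact Nat.subtype_card _ (mem_SS g hg0 n)

lemma hasSum_mul_nn {α β : Type*} {f : α → ℝ} {h : β → ℝ} {a b : ℝ} (hf : HasSum f a)
    (hh : HasSum h b) (hf0 : ∀ x, 0 ≤ f x) (hh0 : ∀ x, 0 ≤ h x) :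
    HasSum (fun p : α × β => f p.1 * h p.2) (a * b) :=
  hf.mul hh (hf.summable.mul_of_nonneg hh.summable hf0 hh0)

lemma finite_gen (g : ℕ → ℕ) (hg0 : g 0 = 0) (r : ℝ) (h0 : 0 < r) (h1 : r < 1)
    (s : Finset (MTy g)) :
    HasSum (fun x : {x : MTy g →₀ ℕ // x.support ⊆ s} => r ^ msize g x.1)
      (∏ t ∈ s, (1 - r ^ t.1)⁻¹) := by
  classical
  induction s using Finset.induction_on with
  | empty =>
    have : Unique {x : MTy g →₀ ℕ // x.support ⊆ ∅} :=
      ⟨⟨⟨0, by simp⟩⟩, fun x => Subtype.ext (by simpa using x.2)⟩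
    have hd : (default : {x : MTy g →₀ ℕ // x.support ⊆ ∅}).1 = 0 := by
      simpa using (default : {x : MTy g →₀ ℕ // x.support ⊆ ∅}).2
    have := hasSum_unique (fun x : {x : MTy g →₀ ℕ // x.support ⊆ ∅} => r ^ msize g x.1)
    rw [hd] at this
    simpa [msize] using this
  | insert t s ht ih =>
    rw [Finset.prod_insert ht]
    have hlt : r ^ t.1 < 1 := pow_lt_one₀ h0.le h1 (ty_pos g hg0 t).ne'
    have hgeo : HasSum (fun j : ℕ => (r ^ t.1) ^ j) (1 - r ^ t.1)⁻¹ := hasSum_geometric_of_lt_one (pow_nonneg h0.le t.1) hlt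
    have hm := hasSum_mul_nn hgeo ih
      (fun j => pow_nonneg (pow_nonneg h0.le _) _) (fun x => pow_nonneg h0.le _)
    let e : ℕ × {x : MTy g →₀ ℕ // x.support ⊆ s} ≃ {x : MTy g →₀ ℕ // x.support ⊆ insert t s} :=
      { toFun := fun p => ⟨Finsupp.single t p.1 + p.2.1, by
          refine Finsupp.support_add.trans (Finset.union_subset ?_ ?_)
          · exact Finsupp.support_single_subset.trans (by simp)
          · exact p.2.2.trans (Finset.subset_insert _ _)⟩
        invFun := fun x => (x.1 t, ⟨x.1.erase t, by
          rw [Finsupp.support_erase]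
          exact Finset.subset_insert_iff.1 x.2⟩)
        left_inv := by
          rintro ⟨j, x, hx⟩
          have hxt : x t = 0 := by
            by_contra h
            exact ht (hx (Finsupp.mem_support_iff.2 h))
          simp only [Prod.mk.injEq, Subtype.mk.injEq]
          refine ⟨by simp [hxt], ?_⟩
          ext a
          by_cases ha : a = t
          · subst ha; simp [hxt]
          · simp [Finsupp.erase_ne ha]
        right_inv := by
          rintro ⟨x, hx⟩
          simp only [Subtype.mk.injEq]
          exact Finsupp.single_add_erase t x }
    rw [← e.hasSum_iff]
    convert hm using 1
    funext p
    simp only [Function.comp_def, e, Equiv.coe_fn_mk]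
    rw [msize_add, msize_single, pow_add, mul_comm p.1, pow_mul]

lemma ty_summable (g : ℕ → ℕ) (r : ℝ) (h0 : 0 < r)
    (hs : Summable (fun n => (g n : ℝ) * r ^ n)) : Summable (fun t : MTy g => r ^ t.1) := by
  rw [summable_sigma_of_nonneg (fun a => by positivity)]
  refine ⟨fun k => Summable.of_finite, ?_⟩
  simpa using hs

lemma boltz (g : ℕ → ℕ) (hg0 : g 0 = 0) (r : ℝ) (h0 : 0 < r) (h1 : r < 1)
    (hs : Summable (fun n => (g n : ℝ) * r ^ n)) :
    0 < (∏' t : MTy g, (1 - r ^ t.1)) ∧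
    HasSum (fun x : MTy g →₀ ℕ => r ^ msize g x) (∏' t : MTy g, (1 - r ^ t.1))⁻¹ := by
  classical
  have hp : ∀ t : MTy g, 0 < 1 - r ^ t.1 := fun t => by
    have : r ^ t.1 < 1 := pow_lt_one₀ h0.le h1 (ty_pos g hg0 t).ne'
    linarith
  have hl : Summable (fun t : MTy g => Real.log (1 - r ^ t.1)) := by
    have := Real.summable_log_one_add_of_summable (ty_summable g r h0 hs).neg
    simpa [sub_eq_add_neg] using this
  have hZ := Real.rexp_tsum_eq_tprod hp hl
  have hM : HasProd (fun t : MTy g => 1 - r ^ t.1) (∏' t : MTy g, (1 - r ^ t.1)) :=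
    (Real.multipliable_of_summable_log hp hl).hasProd
  have hZp : 0 < (∏' t : MTy g, (1 - r ^ t.1)) := by rw [← hZ]; exact Real.exp_pos _
  set Z := ∏' t : MTy g, (1 - r ^ t.1) with hZdef
  refine ⟨hZp, ?_⟩
  have hlim : Filter.Tendsto (fun s : Finset (MTy g) => ∏ t ∈ s, (1 - r ^ t.1)⁻¹) Filter.atTop
      (nhds Z⁻¹) := by
    have := Filter.Tendsto.inv₀ (show Filter.Tendsto _ _ _ from hM) hZp.ne'
    simpa using this
  have hmono : Monotone (fun s : Finset (MTy g) => ∏ t ∈ s, (1 - r ^ t.1)⁻¹) := by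
    intro s s' hss
    have hge1 : ∀ t : MTy g, 1 ≤ (1 - r ^ t.1)⁻¹ := by
      intro t
      refine (one_le_inv₀ (hp t)).2 ?_
      have : 0 < r ^ t.1 := by positivity
      linarith
    simp only
    rw [← Finset.prod_sdiff hss]
    refine le_mul_of_one_le_left (Finset.prod_nonneg fun t _ => (inv_pos.2 (hp t)).le) ?_
    exact Finset.one_le_prod (fun t _ => hge1 t)
  have hub : ∀ s : Finset (MTy g), ∏ t ∈ s, (1 - r ^ t.1)⁻¹ ≤ Z⁻¹ := fun s => hmono.ge_of_tendsto hlim s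
  have hpart : ∀ u : Finset (MTy g →₀ ℕ), ∑ x ∈ u, r ^ msize g x ≤ Z⁻¹ := by
    intro u
    refine le_trans ?_ (hub (u.biUnion Finsupp.support))
    have hf := finite_gen g hg0 r h0 h1 (u.biUnion Finsupp.support)
    have := sum_le_hasSum (u.subtype (fun x => x.support ⊆ u.biUnion Finsupp.support))
      (fun x _ => by positivity) hf
    refine le_trans (le_of_eq ?_) this
    rw [Finset.sum_subtype_of_mem (fun x => r ^ msize g x)]
    intro x hx
    exact Finset.subset_biUnion_of_mem Finsupp.support hx
  have hsum : Summable (fun x : MTy g →₀ ℕ => r ^ msize g x) :=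
    summable_of_sum_le (fun x => by positivity) hpart
  have hle : ∑' x : MTy g →₀ ℕ, r ^ msize g x ≤ Z⁻¹ := hsum.tsum_le_of_sum_le hpart
  have hge : Z⁻¹ ≤ ∑' x : MTy g →₀ ℕ, r ^ msize g x := by
    refine le_of_tendsto' hlim fun s => ?_
    rw [← (finite_gen g hg0 r h0 h1 s).tsum_eq]
    exact hsum.tsum_subtype_le (fun x : MTy g →₀ ℕ => r ^ msize g x) {x | x.support ⊆ s} (fun x => by positivity)
  rw [← le_antisymm hle hge]
  exact hsum.hasSum

/-- number of multisets of size n with all parts of size at most K -/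
noncomputable def cK (g : ℕ → ℕ) (hg0 : g 0 = 0) (K n : ℕ) : Finset (MTy g →₀ ℕ) :=
  (SS g hg0 n).filter (fun x => ∀ t ∈ x.support, t.1 ≤ K)

lemma cK_bound (g : ℕ → ℕ) (hg0 : g 0 = 0) (r : ℝ) (h0 : 0 < r) (h1 : r < 1) (K : ℕ) :
    ∃ D : ℝ, ∀ n, ((cK g hg0 K n).card : ℝ) * r ^ n ≤ D := by
  classical
  let s : Finset (MTy g) := (Finset.range (K + 1)).sigma (fun k => Finset.univ)
  refine ⟨∏ t ∈ s, (1 - r ^ t.1)⁻¹, fun n => ?_⟩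
  have := sum_le_hasSum ((cK g hg0 K n).subtype (fun x => x.support ⊆ s))
      (fun x _ => by positivity) (finite_gen g hg0 r h0 h1 s)
  refine le_trans (le_of_eq ?_) this
  rw [Finset.sum_subtype_of_mem (fun x => r ^ msize g x)]
  · rw [← nsmul_eq_mul, ← Finset.sum_const]
    refine Finset.sum_congr rfl fun x hx => ?_
    simp only [cK, Finset.mem_filter, mem_SS] at hx
    rw [hx.1]
  · intro x hx t ht
    simp only [cK, Finset.mem_filter, mem_SS] at hx
    have := hx.2 t ht
    simp only [s, Finset.mem_sigma, Finset.mem_range, Finset.mem_univ, and_true]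
    omega

lemma count_rec (g : ℕ → ℕ) (hg0 : g 0 = 0) (d : ℕ) (hd : 1 ≤ d) (hgd : ∀ n, ¬ d ∣ n → g n = 0)
    (K m : ℕ) :
    (SS g hg0 (d * m)).card ≤ (cK g hg0 (d * K) (d * m)).card +
      ∑ j ∈ Finset.range (K + 1), (SS g hg0 (d * j)).card * g (d * (m - j)) +
      ∑ i ∈ Finset.Ioo K (m - K), g (d * i) * (SS g hg0 (d * (m - i))).card := by
  classical
  let φ : (k : ℕ) → Fin (g k) × (MTy g →₀ ℕ) → (MTy g →₀ ℕ) :=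
    fun k p => Finsupp.single ⟨k, p.1⟩ 1 + p.2
  let A := (Finset.range (K + 1)).biUnion
    (fun j => (Finset.univ ×ˢ SS g hg0 (d * j)).image (φ (d * (m - j))))
  let B := (Finset.Ioo K (m - K)).biUnion
    (fun i => (Finset.univ ×ˢ SS g hg0 (d * (m - i))).image (φ (d * i)))
  have hsub : SS g hg0 (d * m) ⊆ cK g hg0 (d * K) (d * m) ∪ A ∪ B := by
    intro x hx
    have hx' := (mem_SS g hg0 _ x).1 hx
    by_cases hsm : ∀ t ∈ x.support, t.1 ≤ d * K
    · refine Finset.mem_union_left _ (Finset.mem_union_left _ ?_)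
      exact Finset.mem_filter.2 ⟨hx, hsm⟩
    · push Not at hsm
      obtain ⟨⟨k, a⟩, ht, htK⟩ := hsm
      have hdk : d ∣ k := by
        by_contra h
        have := hgd k h
        rw [this] at a
        exact a.elim0
      obtain ⟨i, rfl⟩ := hdk
      have hiK : K < i := lt_of_mul_lt_mul_left htK (Nat.zero_le d)
      have hxt : x = Finsupp.single ⟨d * i, a⟩ 1 + (x - Finsupp.single ⟨d * i, a⟩ 1) := by
        rw [add_tsub_cancel_of_le]
        rw [Finsupp.single_le_iff]
        exact Nat.one_le_iff_ne_zero.2 (Finsupp.mem_support_iff.1 ht)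
      set y := x - Finsupp.single ⟨d * i, a⟩ 1 with hy
      have hsz : d * i + msize g y = d * m := by
        rw [← hx', hxt, msize_add, msize_single]; simp
      have him : i ≤ m := by
        by_contra h
        have : d * m < d * i := Nat.mul_lt_mul_of_pos_left (not_le.1 h) hd
        omega
      have hysz : msize g y = d * (m - i) := by
        rw [Nat.mul_sub]; omega
      by_cases hmi : m - i ≤ K
      · refine Finset.mem_union_left _ (Finset.mem_union_right _ ?_)
        refine Finset.mem_biUnion.2 ⟨m - i, by simp; omega, ?_⟩
        have hh : m - (m - i) = i := by omega
        rw [hh]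
        exact Finset.mem_image.2 ⟨(a, y), by simp [mem_SS, hysz], hxt.symm⟩
      · refine Finset.mem_union_right _ ?_
        refine Finset.mem_biUnion.2 ⟨i, by simp; omega, ?_⟩
        exact Finset.mem_image.2 ⟨(a, y), by simp [mem_SS, hysz], hxt.symm⟩
  refine (Finset.card_le_card hsub).trans ((Finset.card_union_le _ _).trans ?_)
  refine add_le_add ((Finset.card_union_le _ _).trans (add_le_add le_rfl ?_)) ?_
  · refine Finset.card_biUnion_le.trans (Finset.sum_le_sum fun j _ => ?_)
    refine Finset.card_image_le.trans ?_
    rw [Finset.card_product, Finset.card_univ, Fintype.card_fin, mul_comm]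
  · refine Finset.card_biUnion_le.trans (Finset.sum_le_sum fun j _ => ?_)
    refine Finset.card_image_le.trans ?_
    rw [Finset.card_product, Finset.card_univ, Fintype.card_fin]
lemma fiber_tsum {X : Type*} (w : X → ℝ) (hw : Summable w) (c : X → ℕ) (E : Set ℕ) :
    ∑' j : E, (∑' x, if c x = (j : ℕ) then w x else 0) = ∑' x, (c ⁻¹' E).indicator w x := by
  classical
  have h := (hw.indicator (c ⁻¹' E)).hasSum.tsum_fiberwise c
  rw [← h.tsum_eq, tsum_subtype E (fun j : ℕ => ∑' x, if c x = j then w x else 0)]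
  refine tsum_congr fun j => ?_
  rw [tsum_subtype (c ⁻¹' {j}) ((c ⁻¹' E).indicator w)]
  by_cases hj : j ∈ E
  · rw [Set.indicator_of_mem hj]
    refine tsum_congr fun x => ?_
    by_cases hx : c x = j
    · have h1 : x ∈ c ⁻¹' {j} := hx
      have h2 : x ∈ c ⁻¹' E := by rw [Set.mem_preimage, hx]; exact hj
      rw [if_pos hx, Set.indicator_of_mem h1, Set.indicator_of_mem h2]
    · have h1 : x ∉ c ⁻¹' {j} := hx
      rw [if_neg hx, Set.indicator_of_notMem h1]
  · rw [Set.indicator_of_notMem hj]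
    symm
    rw [← tsum_zero (β := X)]
    refine tsum_congr fun x => ?_
    by_cases hx : c x = j
    · have h1 : x ∈ c ⁻¹' {j} := hx
      have h2 : x ∉ c ⁻¹' E := by rw [Set.mem_preimage, hx]; exact hj
      rw [Set.indicator_of_mem h1, Set.indicator_of_notMem h2]
    · have h1 : x ∉ c ⁻¹' {j} := hx
      rw [Set.indicator_of_notMem h1]

lemma compl_tsum {X : Type*} (w : X → ℝ) (hw : HasSum w 1) (c : X → ℕ) (E : Set ℕ) :
    ∑' x, (c ⁻¹' E).indicator w x + ∑' x, (c ⁻¹' Eᶜ).indicator w x = 1 := by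
  rw [← (hw.summable.indicator _).tsum_add (hw.summable.indicator _), ← hw.tsum_eq]
  refine tsum_congr fun x => ?_
  rw [Set.preimage_compl]
  exact congrFun (Set.indicator_self_add_compl (c ⁻¹' E) w) x

lemma dvd_msize (g : ℕ → ℕ) (d : ℕ) (hgd : ∀ n, ¬ d ∣ n → g n = 0) (x : MTy g →₀ ℕ) :
    d ∣ msize g x := by
  refine Finset.dvd_sum fun t _ => Dvd.dvd.mul_left ?_ _
  by_contra h
  rcases t with ⟨k, a⟩
  have := hgd k h
  rw [this] at a
  exact a.elim0

lemma hasSum_u (g : ℕ → ℕ) (hg0 : g 0 = 0) (d : ℕ) (hd : 1 ≤ d) (hgd : ∀ n, ¬ d ∣ n → g n = 0)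
    (r G : ℝ) (h : HasSum (fun x : MTy g →₀ ℕ => r ^ msize g x) G) :
    HasSum (fun m => ((SS g hg0 (d * m)).card : ℝ) * r ^ (d * m)) G := by
  have h1 : HasSum (fun n => ((SS g hg0 n).card : ℝ) * r ^ n) G := by
    have h' := h.tsum_fiberwise (msize g)
    have hfun : (fun n => ((SS g hg0 n).card : ℝ) * r ^ n) =
        fun n => ∑' b : (msize g ⁻¹' {n}), r ^ msize g b := by
     funext n
     have e : ∀ b : (msize g ⁻¹' {n}), r ^ msize g b = r ^ n := by
       rintro ⟨b, hb⟩
       have hb : msize g b = n := hb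
       simp only [hb]
     rw [tsum_congr e, tsum_const, nsmul_eq_mul, ← card_SS]
     rfl
    rw [hfun]; exact h'
  have hinj : Function.Injective (fun m : ℕ => d * m) := fun a b hab => Nat.eq_of_mul_eq_mul_left hd hab
  refine (hinj.hasSum_iff ?_).2 h1
  intro n hn
  have hdn : ¬ d ∣ n := by
    rintro ⟨k, rfl⟩; exact hn ⟨k, rfl⟩
  have : SS g hg0 n = ∅ := by
    refine Finset.eq_empty_of_forall_notMem fun x hx => hdn ?_
    rw [← (mem_SS g hg0 n x).1 hx]; exact dvd_msize g d hgd x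
  simp [this]

lemma conv_eq (g : ℕ → ℝ) (d : ℕ) (hd : 1 ≤ d) (hgd : ∀ n, ¬ d ∣ n → g n = 0) (m : ℕ) :
    ∑ i ∈ Finset.range (d * m + 1), g i * g (d * m - i) =
    ∑ l ∈ Finset.range (m + 1), g (d * l) * g (d * (m - l)) := by
  symm
  have hinj : Function.Injective (fun m : ℕ => d * m) := fun a b hab => Nat.eq_of_mul_eq_mul_left hd hab
  have e := Finset.sum_image (s := Finset.range (m + 1)) (f := fun i => g i * g (d * m - i))
    (g := fun l => d * l) hinj.injOn
  simp only [Nat.mul_sub]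
  rw [← e]
  refine Finset.sum_subset ?_ ?_
  · intro i hi
    obtain ⟨l, hl, rfl⟩ := Finset.mem_image.1 hi
    have := Nat.mul_le_mul_left d (Nat.lt_succ_iff.1 (Finset.mem_range.1 hl))
    exact Finset.mem_range.2 (by simpa using Nat.lt_succ_of_le this)
  · intro i hi hn
    rw [hgd i, zero_mul]
    rintro ⟨l, rfl⟩
    refine hn (Finset.mem_image.2 ⟨l, ?_, rfl⟩)
    have := Nat.lt_succ_iff.1 (Finset.mem_range.1 hi)
    have := Nat.le_of_mul_le_mul_left this hd
    exact Finset.mem_range.2 (by omega)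

lemma asymp (d : ℕ) (g : ℕ → ℕ) (ρ : ℝ) (hg0 : g 0 = 0) (hρ1 : ρ < 1)
    (hsub : SubexpClass d (fun k => (g k : ℝ)) ρ) :
    (∀ C, (∏' t : MTy g, (1 - ρ ^ t.1))⁻¹ < C → ∀ᶠ m in atTop,
      ((SS g hg0 (d * m)).card : ℝ) ≤ C * g (d * m)) ∧
    (∀ l, Tendsto (fun m => (g (d * (m - l)) : ℝ) / g (d * m)) atTop (𝓝 (ρ ^ (d * l)))) := by
  obtain ⟨hd, hρ0, -, hgd, ⟨N, hN⟩, hsum, -, hrat, hconv⟩ := hsub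
  have hgd' : ∀ n, ¬ d ∣ n → g n = 0 := fun n hn => Nat.cast_eq_zero.1 (hgd n hn : (g n : ℝ) = 0)
  obtain ⟨hZ, hB⟩ := boltz g hg0 ρ hρ0 hρ1 hsum
  set G := (∏' t : MTy g, (1 - ρ ^ t.1))⁻¹ with hGdef
  let f : ℕ → ℝ := fun m => (g (d * m) : ℝ) * ρ ^ (d * m)
  let u : ℕ → ℝ := fun m => ((SS g hg0 (d * m)).card : ℝ) * ρ ^ (d * m)
  have hgp : ∀ n, N ≤ n → (0 : ℝ) < g (d * n) := fun n hn =>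
    hN (d * n) (hn.trans (Nat.le_mul_of_pos_left n hd)) (dvd_mul_right _ _)
  have hpos : ∃ N, ∀ n, N ≤ n → 0 < f n := ⟨N, fun n hn => mul_pos (hgp n hn) (by positivity)⟩
  have hr : Tendsto (fun m => f m / f (m + 1)) atTop (𝓝 1) := by
    have h1 := hrat.mul_const ((ρ ^ d)⁻¹)
    rw [mul_inv_cancel₀ (by positivity)] at h1
    refine h1.congr' ?_
    filter_upwards [eventually_ge_atTop N] with m hm
    have := (hgp (m + 1) (by omega)).ne'
    simp only [f]
    rw [Nat.mul_add, mul_one] at *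
    rw [pow_add]
    field_simp
  have hinj : Function.Injective (fun m : ℕ => d * m) := fun a b hab => Nat.eq_of_mul_eq_mul_left hd hab
  have hF : HasSum f (∑' n, (g n : ℝ) * ρ ^ n) := by
    refine (hinj.hasSum_iff ?_).2 hsum.hasSum
    intro n hn
    have hdn : ¬ d ∣ n := by
      rintro ⟨k, rfl⟩; exact hn ⟨k, rfl⟩
    simp [hgd' n hdn]
  have hU : HasSum u G := hasSum_u g hg0 d hd hgd' ρ G hB
  have hc : Tendsto (fun m => (∑ i ∈ Finset.range (m + 1), f i * f (m - i)) / f m) atTop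
      (𝓝 (2 * ∑' n, (g n : ℝ) * ρ ^ n)) := by
    refine hconv.congr fun m => ?_
    rw [conv_eq (fun k => (g k : ℝ)) d hd hgd m]
    have : ∑ i ∈ Finset.range (m + 1), f i * f (m - i) =
        (∑ i ∈ Finset.range (m + 1), (g (d * i) : ℝ) * g (d * (m - i))) * ρ ^ (d * m) := by
      rw [Finset.sum_mul]
      refine Finset.sum_congr rfl fun i hi => ?_
      have hi := Finset.mem_range.1 hi
      have e : d * m = d * i + d * (m - i) := by rw [← Nat.mul_add]; congr 1; omega
      simp only [f]
      rw [e, pow_add]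
      ring
    rw [this, mul_div_mul_right _ _ (by positivity)]
  let e : ℕ → ℕ → ℝ := fun K m => ((cK g hg0 (d * K) (d * m)).card : ℝ) * ρ ^ (d * m)
  have he : ∀ K, Tendsto (fun m => e K m / f m) atTop (𝓝 0) := by
    intro K
    obtain ⟨r, hr1, hr2⟩ := exists_between hρ1
    have hr0 : 0 < r := hρ0.trans hr1
    obtain ⟨D, hD⟩ := cK_bound g hg0 r hr0 hr2 (d * K)
    have hq1 : (ρ / r) ^ d < 1 := pow_lt_one₀ (by positivity) ((div_lt_one hr0).2 hr1) (by omega)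
    have h1 := (aux_geom f hpos hr ((ρ / r) ^ d) (by positivity) hq1).const_mul D
    rw [mul_zero] at h1
    refine squeeze_zero (fun m => by positivity) (fun m => ?_) h1
    rw [← mul_div_assoc]
    refine div_le_div_of_nonneg_right ?_ (by positivity)
    have h2 := mul_le_mul_of_nonneg_right (hD (d * m)) (show 0 ≤ ((ρ / r) ^ d) ^ m by positivity)
    refine le_trans (le_of_eq ?_) h2
    simp only [e]
    rw [← pow_mul, mul_assoc, ← mul_pow, mul_div_cancel₀ _ hr0.ne']
  have hrec : ∀ K m, u m ≤ e K m + ∑ j ∈ Finset.range (K + 1), u j * f (m - j) +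
      ∑ i ∈ Finset.Ioo K (m - K), f i * u (m - i) := by
    intro K m
    by_cases hKm : m < K
    · have : u m ≤ e K m := by
        refine mul_le_mul_of_nonneg_right ?_ (by positivity)
        have hss : SS g hg0 (d * m) ⊆ cK g hg0 (d * K) (d * m) := by
          intro x hx
          refine Finset.mem_filter.2 ⟨hx, fun t ht => ?_⟩
          have h1 := le_msize g x t
          rw [(mem_SS g hg0 _ x).1 hx] at h1
          have h2 := Nat.pos_of_ne_zero (Finsupp.mem_support_iff.1 ht)
          have h3 : d * m ≤ d * K := Nat.mul_le_mul_left d hKm.le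
          nlinarith
        exact_mod_cast Finset.card_le_card hss
      have a1 : 0 ≤ ∑ j ∈ Finset.range (K + 1), u j * f (m - j) :=
        Finset.sum_nonneg fun j _ => by positivity
      have a2 : 0 ≤ ∑ i ∈ Finset.Ioo K (m - K), f i * u (m - i) :=
        Finset.sum_nonneg fun j _ => by positivity
      linarith
    have h1 : ((SS g hg0 (d * m)).card : ℝ) ≤ (cK g hg0 (d * K) (d * m)).card +
      ∑ j ∈ Finset.range (K + 1), ((SS g hg0 (d * j)).card : ℝ) * g (d * (m - j)) +
      ∑ i ∈ Finset.Ioo K (m - K), (g (d * i) : ℝ) * (SS g hg0 (d * (m - i))).card := by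
      exact_mod_cast count_rec g hg0 d hd hgd' K m
    have h2 := mul_le_mul_of_nonneg_right h1 (show 0 ≤ ρ ^ (d * m) by positivity)
    refine h2.trans (le_of_eq ?_)
    rw [add_mul, add_mul, Finset.sum_mul, Finset.sum_mul]
    have hpw : ∀ i ≤ m, ρ ^ (d * m) = ρ ^ (d * i) * ρ ^ (d * (m - i)) := by
      intro i hi
      rw [← pow_add, ← Nat.mul_add]; congr 2; omega
    congr 1
    · congr 1
      refine Finset.sum_congr rfl fun i hi => ?_
      have hi := Finset.mem_range.1 hi
      rw [hpw i (by omega)]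
      simp only [f, u]; ring
    · refine Finset.sum_congr rfl fun i hi => ?_
      have hi := Finset.mem_Ioo.1 hi
      rw [hpw i (by omega)]
      simp only [f, u]; ring
  refine ⟨fun C hC => ?_, fun l => ?_⟩
  · have := aux_main f u (fun n => by positivity) (fun n => by positivity) hpos hr _ G hF hU hc
      e he hrec C hC
    filter_upwards [this] with m hm
    simp only [f, u, ← mul_assoc] at hm
    exact le_of_mul_le_mul_right hm (by positivity)
  · have h1 := (aux_shift f hpos hr l).mul_const (ρ ^ (d * l))
    rw [one_mul] at h1
    refine h1.congr' ?_
    filter_upwards [eventually_ge_atTop (N + l)] with m hm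
    have := (hgp m (by omega)).ne'
    have e : d * m = d * l + d * (m - l) := by rw [← Nat.mul_add]; congr 1; omega
    simp only [f]
    rw [e, pow_add, ← e]
    field_simp

lemma count_lower (g : ℕ → ℕ) (hg0 : g 0 = 0) (n : ℕ) (U : Finset (MTy g →₀ ℕ))
    (hU : ∀ x ∈ U, 2 * msize g x < n) (E : Set ℕ) [DecidablePred (· ∈ E)]
    (hE : ∀ x ∈ U, ccount g x + 1 ∈ E) :
    ∑ x ∈ U, g (n - msize g x) ≤ ((SS g hg0 n).filter (fun y => ccount g y ∈ E)).card := by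
  classical
  have hc : ∑ x ∈ U, g (n - msize g x) =
      (U.sigma (fun x => (Finset.univ : Finset (Fin (g (n - msize g x)))))).card := by
    simp [Finset.card_sigma]
  rw [hc]
  refine Finset.card_le_card_of_injOn
    (fun p => Finsupp.single (⟨n - msize g p.1, p.2⟩ : MTy g) 1 + p.1) ?_ ?_
  · rintro ⟨x, i⟩ hx
    have hx : x ∈ U := (Finset.mem_sigma.1 hx).1
    have := hU x hx
    refine Finset.mem_filter.2 ⟨(mem_SS g hg0 _ _).2 ?_, ?_⟩
    · rw [msize_add, msize_single]; simp only; omega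
    · rw [ccount_add, ccount_single, add_comm]; exact hE x hx
  · rintro ⟨x, i⟩ hx ⟨y, j⟩ hy hxy
    have hx := hU x (Finset.mem_sigma.1 hx).1
    have hy := hU y (Finset.mem_sigma.1 hy).1
    simp only at hxy
    have ht : (⟨n - msize g x, i⟩ : MTy g) = ⟨n - msize g y, j⟩ := by
      by_contra hne
      have h1 := DFunLike.congr_fun hxy (⟨n - msize g x, i⟩ : MTy g)
      rw [Finsupp.add_apply, Finsupp.add_apply, Finsupp.single_eq_same,
        Finsupp.single_eq_of_ne hne] at h1
      have h2 := le_msize g y ⟨n - msize g x, i⟩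
      rw [← zero_add (y _), ← h1] at h2
      simp only at h2
      nlinarith [Nat.sub_add_cancel (show msize g x ≤ n by omega)]
    rw [ht] at hxy
    have hxy := add_left_cancel hxy
    subst hxy
    simpa using ht

lemma hasSum_unif (g : ℕ → ℕ) (hg0 : g 0 = 0) (n : ℕ) (hn : 0 < (SS g hg0 n).card) :
    HasSum (pUnif g n) 1 := by
  have h := hasSum_sum_of_ne_finset_zero (L := .unconditional _) (f := pUnif g n) (s := SS g hg0 n) (by
    intro x hx
    rw [mem_SS] at hx
    simp [pUnif, hx])
  convert h using 1
  have : ∀ x ∈ SS g hg0 n, pUnif g n x = ((SS g hg0 n).card : ℝ)⁻¹ := by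
    intro x hx
    rw [mem_SS] at hx
    rw [pUnif, if_pos hx, card_SS g hg0]
  rw [Finset.sum_congr rfl this, Finset.sum_const, nsmul_eq_mul, mul_inv_cancel₀]
  exact_mod_cast hn.ne'

lemma unif_E (g : ℕ → ℕ) (hg0 : g 0 = 0) (n : ℕ) (E : Set ℕ) [DecidablePred (· ∈ E)] :
    ∑' x, (ccount g ⁻¹' E).indicator (pUnif g n) x =
      (((SS g hg0 n).filter (fun y => ccount g y ∈ E)).card : ℝ) / (SS g hg0 n).card := by
  classical
  rw [tsum_eq_sum (s := (SS g hg0 n).filter (fun y => ccount g y ∈ E))]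
  · have : ∀ x ∈ (SS g hg0 n).filter (fun y => ccount g y ∈ E),
        (ccount g ⁻¹' E).indicator (pUnif g n) x = ((SS g hg0 n).card : ℝ)⁻¹ := by
      intro x hx
      rw [Finset.mem_filter, mem_SS] at hx
      rw [Set.indicator_of_mem (show x ∈ ccount g ⁻¹' E from hx.2), pUnif, if_pos hx.1,
        card_SS g hg0]
    rw [Finset.sum_congr rfl this, Finset.sum_const, nsmul_eq_mul, div_eq_mul_inv]
  · intro x hx
    rw [Finset.mem_filter, mem_SS, not_and] at hx
    by_cases h1 : msize g x = n
    · exact Set.indicator_of_notMem (show x ∉ ccount g ⁻¹' E from hx h1) _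
    · have : pUnif g n x = 0 := by rw [pUnif, if_neg h1]
      by_cases h2 : x ∈ ccount g ⁻¹' E
      · rw [Set.indicator_of_mem h2, this]
      · rw [Set.indicator_of_notMem h2]

lemma p_eq (g : ℕ → ℕ) (hg0 : g 0 = 0) (n j : ℕ) :
    (Nat.card {x : MTy g →₀ ℕ // msize g x = n ∧ ccount g x = j} : ℝ)
            / (Nat.card {x : MTy g →₀ ℕ // msize g x = n} : ℝ) =
    ∑' x, if ccount g x = j then pUnif g n x else 0 := by
  classical
  have h := unif_E g hg0 n {j}
  have e : ∀ x, (ccount g ⁻¹' {j}).indicator (pUnif g n) x =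
      if ccount g x = j then pUnif g n x else 0 := by
    intro x
    by_cases hx : ccount g x = j
    · rw [if_pos hx, Set.indicator_of_mem (show x ∈ ccount g ⁻¹' {j} from hx)]
    · rw [if_neg hx, Set.indicator_of_notMem (show x ∉ ccount g ⁻¹' {j} from hx)]
  rw [← tsum_congr e, h, card_SS g hg0]
  congr 2
  refine Nat.subtype_card _ fun x => ?_
  rw [Finset.mem_filter, mem_SS, Set.mem_singleton_iff]

lemma tv_lower (d : ℕ) (g : ℕ → ℕ) (ρ : ℝ) (hg0 : g 0 = 0) (hρ1 : ρ < 1)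
    (hsub : SubexpClass d (fun k => (g k : ℝ)) ρ) (hB : HasSum (pBoltz g ρ) 1)
    (hZ : 0 < ∏' t : MTy g, (1 - ρ ^ t.1)) (ε : ℝ) (hε : 0 < ε) :
    ∀ᶠ m in atTop, 0 < (SS g hg0 (d * m)).card ∧ ∀ E : Set ℕ,
      ∑' x, ((fun x => ccount g x + 1) ⁻¹' E).indicator (pBoltz g ρ) x - ε ≤
      ∑' x, (ccount g ⁻¹' E).indicator (pUnif g (d * m)) x := by
  classical
  obtain ⟨has1, has2⟩ := asymp d g ρ hg0 hρ1 hsub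
  obtain ⟨hd, hρ0, -, hgd, ⟨N, hN⟩, -⟩ := hsub
  have hgd' : ∀ n, ¬ d ∣ n → g n = 0 := fun n hn => Nat.cast_eq_zero.1 (hgd n hn : (g n : ℝ) = 0)
  have hgp : ∀ n, N ≤ n → (0 : ℝ) < g (d * n) := fun n hn =>
    hN (d * n) (hn.trans (Nat.le_mul_of_pos_left n hd)) (dvd_mul_right _ _)
  have hBn : ∀ x, 0 ≤ pBoltz g ρ x := fun x => mul_nonneg hZ.le (by positivity)
  have hUe := (show Tendsto _ _ _ from hB).eventually_const_lt (u := 1 - ε / 2) (by linarith)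
  obtain ⟨U, hU⟩ := hUe.exists
  set δ := ε / (2 * (U.card + 1)) with hδ
  have hδ0 : 0 < δ := by positivity
  set Z := ∏' t : MTy g, (1 - ρ ^ t.1) with hZd
  -- ratio
  have hcard : ∀ᶠ m in atTop, 0 < (SS g hg0 (d * m)).card := by
    filter_upwards [eventually_ge_atTop (N + 1)] with m hm
    have := count_lower g hg0 (d * m) {0} (by
      intro x hx
      rw [Finset.mem_singleton.1 hx]
      simp [msize]; constructor <;> omega) Set.univ (by simp)
    have h2 : 0 < g (d * m) := by exact_mod_cast hgp m (by omega)
    simp [msize] at this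
    omega
  have hrat : ∀ x ∈ U, ∀ᶠ m in atTop,
      pBoltz g ρ x - δ ≤ (g (d * m - msize g x) : ℝ) / (SS g hg0 (d * m)).card := by
    intro x _
    obtain ⟨l, hl⟩ := dvd_msize g d hgd' x
    set κ := Z - min δ Z / 2 with hκ
    have hmp : 0 < min δ Z := lt_min hδ0 hZ
    have hκ0 : 0 < κ := by have := min_le_right δ Z; linarith
    have hκZ : κ < Z := by linarith
    have h1 := has1 κ⁻¹ (inv_strictAnti₀ hκ0 hκZ)
    have hρl : ρ ^ (d * l) ≤ 1 := pow_le_one₀ hρ0.le hρ1.le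
    have hρl0 : 0 < ρ ^ (d * l) := by positivity
    have h2 := ((has2 l).const_mul κ).eventually_const_lt (u := Z * ρ ^ (d * l) - δ) (by
      have := min_le_left δ Z
      rw [hκ]
      nlinarith)
    filter_upwards [h1, h2, hcard, eventually_ge_atTop N] with m b1 b2 b3 b4
    have hg := hgp m b4
    rw [pBoltz, hl, ← hZd, ← Nat.mul_sub]
    refine b2.le.trans ?_
    have b3' : (0 : ℝ) < (SS g hg0 (d * m)).card := by exact_mod_cast b3
    rw [← mul_div_assoc, div_le_div_iff₀ hg b3']
    have b5 : κ * (SS g hg0 (d * m)).card ≤ g (d * m) := by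
      have := mul_le_mul_of_nonneg_left b1 hκ0.le
      rwa [← mul_assoc, mul_inv_cancel₀ hκ0.ne', one_mul] at this
    have := mul_le_mul_of_nonneg_left b5 (Nat.cast_nonneg (α := ℝ) (g (d * (m - l))))
    linarith
  have hrat' := (Finset.eventually_all U).2 hrat
  have hlarge : ∀ᶠ m in atTop, ∀ x ∈ U, 2 * msize g x < d * m := by
    refine (Finset.eventually_all U).2 fun x _ => ?_
    filter_upwards [eventually_gt_atTop (2 * msize g x)] with m hm
    exact lt_of_lt_of_le hm (Nat.le_mul_of_pos_left m hd)
  filter_upwards [hcard, hrat', hlarge] with m c1 c2 c3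
  refine ⟨c1, fun E => ?_⟩
  rw [unif_E g hg0]
  have c1' : (0 : ℝ) < (SS g hg0 (d * m)).card := by exact_mod_cast c1
  set V := U.filter (fun x => ccount g x + 1 ∈ E) with hV
  have hlow := count_lower g hg0 (d * m) V (fun x hx => c3 x (Finset.mem_filter.1 hx).1) E
    (fun x hx => (Finset.mem_filter.1 hx).2)
  have hlow' : ∑ x ∈ V, (g (d * m - msize g x) : ℝ) ≤
      (((SS g hg0 (d * m)).filter (fun y => ccount g y ∈ E)).card : ℝ) := by exact_mod_cast hlow
  have s1 : ∑ x ∈ V, (pBoltz g ρ x - δ) ≤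
      (((SS g hg0 (d * m)).filter (fun y => ccount g y ∈ E)).card : ℝ) / (SS g hg0 (d * m)).card := by
    refine le_trans ?_ (div_le_div_of_nonneg_right hlow' c1'.le)
    rw [Finset.sum_div]
    exact Finset.sum_le_sum fun x hx => c2 x (Finset.mem_filter.1 hx).1
  refine le_trans ?_ s1
  rw [Finset.sum_sub_distrib, Finset.sum_const, nsmul_eq_mul]
  have s2 : (V.card : ℝ) * δ ≤ ε / 2 := by
    have hVU : (V.card : ℝ) ≤ U.card := by exact_mod_cast Finset.card_filter_le _ _
    have : (U.card + 1 : ℝ) * δ = ε / 2 := by rw [hδ]; field_simp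
    nlinarith
  have s3 : ∑' x, ((fun x => ccount g x + 1) ⁻¹' E).indicator (pBoltz g ρ) x ≤
      ∑ x ∈ V, pBoltz g ρ x + ε / 2 := by
    have hsI := hB.summable.indicator ((fun x => ccount g x + 1) ⁻¹' E)
    have t1 := hsI.sum_add_tsum_compl (s := U)
    have t2 := hB.summable.sum_add_tsum_compl (s := U)
    rw [hB.tsum_eq] at t2
    have t3 : ∑ x ∈ U, ((fun x => ccount g x + 1) ⁻¹' E).indicator (pBoltz g ρ) x =
        ∑ x ∈ V, pBoltz g ρ x := by
      rw [hV, Finset.sum_filter]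
      refine Finset.sum_congr rfl fun x _ => ?_
      simp only [Set.indicator_apply, Set.mem_preimage]
    have t4 := Summable.tsum_le_tsum (fun x : ((U : Set (MTy g →₀ ℕ))ᶜ : Set _) =>
      Set.indicator_le_self' (s := (fun x => ccount g x + 1) ⁻¹' E)
        (f := pBoltz g ρ) (fun x _ => hBn x) x.1) (hsI.subtype _) (hB.summable.subtype _)
    rw [t3] at t1
    linarith
  linarith

/-- If `S_n` is a uniformly random multiset of total size `n`, then its number of components
`c(S_n)` converges in total variation, along multiples of `d`, to `1 + ∑_t R(t)` where `R` is
the Boltzmann random multiset. -/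
theorem component_count_total_variation_convergence
    (d : ℕ) (g : ℕ → ℕ) (ρ : ℝ) (hg0 : g 0 = 0) (hρ1 : ρ < 1)
    (hsub : SubexpClass d (fun k => (g k : ℝ)) ρ) :
    Filter.Tendsto
      (fun m => dTV
        (fun j : ℕ =>
          (Nat.card {x : MTy g →₀ ℕ // msize g x = d * m ∧ ccount g x = j} : ℝ)
            / (Nat.card {x : MTy g →₀ ℕ // msize g x = d * m} : ℝ))
        (fun j : ℕ =>
          ∑' x : MTy g →₀ ℕ, if ccount g x + 1 = j then pBoltz g ρ x else 0))
      Filter.atTop (nhds 0) := by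
  have hsub0 := hsub
  obtain ⟨hd, hρ0, -, hgd, -, hsum, -⟩ := hsub0
  obtain ⟨hZ, hBs⟩ := boltz g hg0 ρ hρ0 hρ1 hsum
  have hB : HasSum (pBoltz g ρ) 1 := by
    have h := hBs.mul_left (∏' t : MTy g, (1 - ρ ^ t.1))
    rw [mul_inv_cancel₀ hZ.ne'] at h
    exact h
  rw [Metric.tendsto_atTop']
  intro ε hε
  obtain ⟨N, hN⟩ := Filter.eventually_atTop.1
    (tv_lower d g ρ hg0 hρ1 hsub hB hZ (ε / 2) (by linarith))
  refine ⟨N, fun m hm => ?_⟩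
  obtain ⟨h1, h2⟩ := hN m hm.le
  have hP := hasSum_unif g hg0 (d * m) h1
  rw [Real.dist_eq, sub_zero]
  unfold dTV
  rw [abs_of_nonneg (Real.iSup_nonneg fun E => abs_nonneg _)]
  refine lt_of_le_of_lt (ciSup_le (c := ε / 2) fun E => ?_) (by linarith)
  simp only [p_eq g hg0]
  rw [fiber_tsum (pUnif g (d * m)) hP.summable (ccount g) E,
    fiber_tsum (pBoltz g ρ) hB.summable (fun x => ccount g x + 1) E]
  have a1 := h2 E
  have a2 := h2 Eᶜ
  have a3 := compl_tsum (pUnif g (d * m)) hP (ccount g) E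
  have a4 := compl_tsum (pBoltz g ρ) hB (fun x => ccount g x + 1) E
  rw [abs_le]
  constructor <;> linarith
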